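/- For every LTL formula φ and all subsets U, V ⊆ el(φ) with U ≠ V, the languages L(A_φ^U) and L(A_φ^V) are disjoint: L(A_φ^U) ∩ L(A_φ^V) = ∅. -/

import Mathlib

open scoped ENNReal

/-- LTL formulas over atomic propositions `AP`. -/
inductive LTL (AP : Type) : Type
  | atom : AP → LTL AP
  | neg : LTL AP → LTL AP
  | conj : LTL AP → LTL AP → LTL AP
  | next : LTL AP → LTL AP
  | untl : LTL AP → LTL AP → LTL AP

namespace LTL

/-- Semantics of LTL over infinite words `w : ℕ → Set AP`. -/
def Sat {AP : Type} : (ℕ → Set AP) → LTL AP → Prop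
  | w, atom p => p ∈ w 0
  | w, neg φ => ¬ Sat w φ
  | w, conj φ ψ => Sat w φ ∧ Sat w ψ
  | w, next φ => Sat (fun i => w (i + 1)) φ
  | w, untl φ ψ =>
      ∃ j : ℕ, Sat (fun i => w (i + j)) ψ ∧ ∀ i < j, Sat (fun k => w (k + i)) φ

/-- `Subf ψ φ` : `ψ` is a subformula of `φ`. -/
inductive Subf {AP : Type} : LTL AP → LTL AP → Prop
  | refl (φ : LTL AP) : Subf φ φ
  | negI {ψ φ : LTL AP} : Subf ψ φ → Subf ψ (neg φ)
  | conjL {ψ φ₁ φ₂ : LTL AP} : Subf ψ φ₁ → Subf ψ (conj φ₁ φ₂)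
  | conjR {ψ φ₁ φ₂ : LTL AP} : Subf ψ φ₂ → Subf ψ (conj φ₁ φ₂)
  | nextI {ψ φ : LTL AP} : Subf ψ φ → Subf ψ (next φ)
  | untlL {ψ φ₁ φ₂ : LTL AP} : Subf ψ φ₁ → Subf ψ (untl φ₁ φ₂)
  | untlR {ψ φ₁ φ₂ : LTL AP} : Subf ψ φ₂ → Subf ψ (untl φ₁ φ₂)

/-- Elementary formulas `el φ`. -/
def el {AP : Type} : LTL AP → Set (LTL AP)
  | atom _ => ∅
  | neg ψ => el ψ
  | conj φ ψ => el φ ∪ el ψ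
  | next ψ => insert (next ψ) (el ψ)
  | untl φ ψ => insert (next (untl φ ψ)) (el φ ∪ el ψ)

/-- The satisfaction relation `(V, a) ⊩ ψ`. -/
def sd {AP : Type} (V : Set (LTL AP)) (a : Set AP) : LTL AP → Prop
  | atom p => p ∈ a
  | neg ψ => ¬ sd V a ψ
  | conj φ ψ => sd V a φ ∧ sd V a ψ
  | next ψ => next ψ ∈ V
  | untl φ ψ => sd V a ψ ∨ (sd V a φ ∧ next (untl φ ψ) ∈ V)

end LTL

/-- A generalized Büchi automaton with alphabet `Al` and state space `Q`. -/
structure GBA (Al : Type) (Q : Type) where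
  T : Q → Al → Set Q
  init : Set Q
  acc : Set (Set (Q × Al × Q))

namespace GBA

variable {Al Q : Type}

/-- A run of the automaton over the word `w`. -/
def IsRun (Au : GBA Al Q) (w : ℕ → Al) (ρ : ℕ → Q) : Prop :=
  ρ 0 ∈ Au.init ∧ ∀ i, ρ (i + 1) ∈ Au.T (ρ i) (w i)

/-- An accepting run: for each accepting set, some transition in it occurs at
infinitely many positions. -/
def IsAcceptingRun (Au : GBA Al Q) (w : ℕ → Al) (ρ : ℕ → Q) : Prop :=
  Au.IsRun w ρ ∧ ∀ F ∈ Au.acc, {i : ℕ | (ρ i, w i, ρ (i + 1)) ∈ F}.Infinite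

/-- The language of the automaton. -/
def Lang (Au : GBA Al Q) : Set (ℕ → Al) :=
  {w | ∃ ρ : ℕ → Q, Au.IsAcceptingRun w ρ}

/-- The automaton `Au` with single initial state `q`. -/
def from1 (Au : GBA Al Q) (q : Q) : GBA Al Q :=
  { Au with init := {q} }

/-- The language of the automaton started in state `q`. -/
def LangFrom (Au : GBA Al Q) (q : Q) : Set (ℕ → Al) :=
  (Au.from1 q).Lang

/-- Separated automaton: distinct states recognize disjoint languages. -/
def Separated (Au : GBA Al Q) : Prop :=
  ∀ q q' : Q, q ≠ q' → Au.LangFrom q ∩ Au.LangFrom q' = ∅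

/-- Reverse determinism: every state has exactly one `a`-predecessor for each letter `a`. -/
def RevDet (Au : GBA Al Q) : Prop :=
  ∀ (q' : Q) (a : Al), ∃! q : Q, q' ∈ Au.T q a

/-- Fully partitioned automaton: separated, every word is accepted from some
state, and reverse deterministic. -/
def FullyPartitioned (Au : GBA Al Q) : Prop :=
  Au.Separated ∧ (∀ w : ℕ → Al, ∃ q : Q, w ∈ Au.LangFrom q) ∧ Au.RevDet

/-- A state is reenterable if it has some predecessor. -/
def Reenterable (Au : GBA Al Q) (q : Q) : Prop :=
  ∃ (p : Q) (a : Al), q ∈ Au.T p a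

/-- The restriction of an automaton to its reenterable states, all of them initial. -/
def restrict (Au : GBA Al Q) : GBA Al {q : Q // Au.Reenterable q} where
  T q a := {q' | q'.1 ∈ Au.T q.1 a}
  init := Set.univ
  acc := (fun F => {t : {q : Q // Au.Reenterable q} × Al × {q : Q // Au.Reenterable q} |
            (t.1.1, t.2.1, t.2.2.1) ∈ F}) '' Au.acc

/-- Almost fully partitioned: the restriction to reenterable states is fully partitioned. -/
def AlmostFullyPartitioned (Au : GBA Al Q) : Prop :=
  Au.restrict.FullyPartitioned

end GBA

/-- The transition function of the automaton `A_φ`; the state `none` is the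
initial state `φ`, the state `some V` is the subset state `V ⊆ el φ`. -/
def autT {AP : Type} (φ : LTL AP) :
    Option (Set (LTL AP)) → Set AP → Set (Option (Set (LTL AP)))
  | none, a => {q' | ∃ V : Set (LTL AP), q' = some V ∧ V ⊆ φ.el ∧ LTL.sd V a φ}
  | some V, a => {q' | ∃ U : Set (LTL AP), q' = some U ∧ U ⊆ φ.el ∧
      ∀ ψ : LTL AP, LTL.next ψ ∈ φ.el → (LTL.next ψ ∈ V ↔ LTL.sd U a ψ)}

/-- The generalized Büchi automaton `A_φ` of an LTL formula `φ`. -/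
def aut {AP : Type} (φ : LTL AP) : GBA (Set AP) (Option (Set (LTL AP))) where
  T := autT φ
  init := {none}
  acc := {F | ∃ φ₁ φ₂ : LTL AP, LTL.Subf (LTL.untl φ₁ φ₂) φ ∧
    F = {t : Option (Set (LTL AP)) × Set AP × Option (Set (LTL AP)) |
          t.2.2 ∈ autT φ t.1 t.2.1 ∧
          ∃ V : Set (LTL AP), t.2.2 = some V ∧
            (LTL.sd V t.2.1 φ₂ ∨ ¬ LTL.sd V t.2.1 (LTL.untl φ₁ φ₂))}}

/-- The automaton `A_φ^U` for `U ⊆ el φ`. -/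
def autFrom {AP : Type} (φ : LTL AP) (U : Set (LTL AP)) :
    GBA (Set AP) (Option (Set (LTL AP))) :=
  (aut φ).from1 (some U)

/-- A (finite, labelled) Markov chain with state space `S` and labels in `Al`. -/
structure MC (S : Type) (Al : Type) where
  L : S → Al
  init : S
  P : S → S → ℝ≥0∞

namespace MC

variable {S Al : Type}

/-- The edge relation of the underlying graph of the Markov chain. -/
def E (M : MC S Al) : S → S → Prop := fun s s' => 0 < M.P s s'

/-- The labelled word generated by a path of the Markov chain. -/
def word (M : MC S Al) (π : ℕ → S) : ℕ → Al := fun i => M.L (π i)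

end MC

/-- The edge relation of the product graph `A × M`. -/
def prodE {S Al Q : Type} (Au : GBA Al Q) (M : MC S Al) : Q × S → Q × S → Prop :=
  fun v v' => M.E v.2 v'.2 ∧ v'.1 ∈ Au.T v.1 (M.L v.2)

/-- All vertices of `C` are mutually reachable. -/
def MutReach {V : Type} (E : V → V → Prop) (C : Set V) : Prop :=
  ∀ u ∈ C, ∀ v ∈ C, Relation.ReflTransGen E u v

/-- `C` is a (non-extensible, i.e. maximal) strongly connected component. -/
def IsSCC {V : Type} (E : V → V → Prop) (C : Set V) : Prop :=
  C.Nonempty ∧ MutReach E C ∧ ∀ C' : Set V, C ⊆ C' → MutReach E C' → C' = C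

/-- `SCCle E C C'` : some vertex of `C'` is reachable from some vertex of `C`. -/
def SCCle {V : Type} (E : V → V → Prop) (C C' : Set V) : Prop :=
  ∃ u ∈ C, ∃ v ∈ C', Relation.ReflTransGen E u v

/-- A bottom SCC: an SCC maximal with respect to reachability. -/
def IsBSCC {V : Type} (E : V → V → Prop) (C : Set V) : Prop :=
  IsSCC E C ∧ ∀ C' : Set V, IsSCC E C' → SCCle E C C' → C' = C

/-- A finite path of the graph `E` lying in the set `C`. -/
def FinPathIn {V : Type} (E : V → V → Prop) (C : Set V) (l : List V) : Prop :=
  l.Chain' E ∧ ∀ v ∈ l, v ∈ C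

/-- An infinite path of the graph `E` lying in the set `C`. -/
def InfPathIn {V : Type} (E : V → V → Prop) (C : Set V) (π : ℕ → V) : Prop :=
  (∀ i, E (π i) (π (i + 1))) ∧ ∀ i, π i ∈ C

/-- The infinite path `π` visits the finite path `l` infinitely often, i.e. `l`
occurs as a contiguous fragment starting at infinitely many positions of `π`. -/
def VisitsInfOften {V : Type} (π : ℕ → V) (l : List V) : Prop :=
  {n : ℕ | ∀ i : Fin l.length, π (n + i.1) = l.get i}.Infinite

/-- The projection `H(C)` of a set of product vertices to the Markov chain. -/
def Hproj {Q S : Type} (C : Set (Q × S)) : Set S := Prod.snd '' C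

/-- A complete SCC of the product graph: every finite path of `H(C)` is the
projection of some finite path in `C`. -/
def CompleteSCC {S Al Q : Type} (Au : GBA Al Q) (M : MC S Al) (C : Set (Q × S)) : Prop :=
  ∀ l : List S, FinPathIn M.E (Hproj C) l →
    ∃ σ : List (Q × S), FinPathIn (prodE Au M) C σ ∧ σ.map Prod.snd = l

/-- An accepting SCC of the product graph. -/
def AcceptingSCC {S Al Q : Type} (Au : GBA Al Q) (M : MC S Al) (C : Set (Q × S)) : Prop :=
  ∀ F ∈ Au.acc, ∃ v ∈ C, ∃ v' ∈ C, prodE Au M v v' ∧ (v.1, M.L v.2, v'.1) ∈ F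

/-- A locally positive SCC: accepting, complete, and `H(C)` is a bottom SCC of
the underlying graph of `M`. -/
def LocallyPositive {S Al Q : Type} (Au : GBA Al Q) (M : MC S Al) (C : Set (Q × S)) : Prop :=
  AcceptingSCC Au M C ∧ CompleteSCC Au M C ∧ IsBSCC M.E (Hproj C)

/-- The σ-algebra on `ℕ → S` generated by the cylinder sets. -/
def CylSigma (S : Type) : MeasurableSpace (ℕ → S) :=
  MeasurableSpace.generateFrom
    {A : Set (ℕ → S) | ∃ l : List S, A = {π | ∀ i : Fin l.length, π i.1 = l.get i}}

/-- `μ` is the path measure of the Markov chain with transition matrix `P` and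
initial state `s`: the measure of each cylinder is the product of the transition
probabilities along it. -/
def IsPathMeasure {S : Type} [DecidableEq S] (P : S → S → ℝ≥0∞) (s : S)
    (μ : @MeasureTheory.Measure (ℕ → S) (CylSigma S)) : Prop :=
  ∀ (k : ℕ) (f : ℕ → S),
    μ {π | ∀ i ≤ k, π i = f i} =
      (if f 0 = s then 1 else 0) * ∏ i ∈ Finset.range k, P (f i) (f (i + 1))

namespace LTL

theorem Subf.trans {AP : Type} {χ ψ φ : LTL AP} (h₁ : Subf χ ψ) (h₂ : Subf ψ φ) :
    Subf χ φ := by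
  induction h₂ with
  | refl => exact h₁
  | negI _ ih => exact .negI ih
  | conjL _ ih => exact .conjL ih
  | conjR _ ih => exact .conjR ih
  | nextI _ ih => exact .nextI ih
  | untlL _ ih => exact .untlL ih
  | untlR _ ih => exact .untlR ih

theorem Subf.el_subset {AP : Type} {ψ φ : LTL AP} (h : Subf ψ φ) : ψ.el ⊆ φ.el := by
  induction h with
  | refl => exact subset_rfl
  | negI _ ih => exact ih
  | conjL _ ih => exact fun _ hx => Or.inl (ih hx)
  | conjR _ ih => exact fun _ hx => Or.inr (ih hx)
  | nextI _ ih => exact fun _ hx => Or.inr (ih hx)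
  | untlL _ ih => exact fun _ hx => Or.inr (Or.inl (ih hx))
  | untlR _ ih => exact fun _ hx => Or.inr (Or.inr (ih hx))

/-- Elementary formulas of `φ` have the form `Xψ` with `ψ` a subformula of `φ`. -/
theorem exists_eq_next_of_mem_el {AP : Type} {χ φ : LTL AP} (h : χ ∈ φ.el) :
    ∃ ψ, χ = next ψ ∧ Subf ψ φ := by
  induction φ with
  | atom p => exact h.elim
  | neg φ ih =>
    obtain ⟨ψ, rfl, hψ⟩ := ih h
    exact ⟨ψ, rfl, .negI hψ⟩
  | conj φ₁ φ₂ ih₁ ih₂ =>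
    rcases h with h | h
    · obtain ⟨ψ, rfl, hψ⟩ := ih₁ h
      exact ⟨ψ, rfl, .conjL hψ⟩
    · obtain ⟨ψ, rfl, hψ⟩ := ih₂ h
      exact ⟨ψ, rfl, .conjR hψ⟩
  | next φ ih =>
    rcases h with rfl | h
    · exact ⟨φ, rfl, .nextI (.refl φ)⟩
    · obtain ⟨ψ, rfl, hψ⟩ := ih h
      exact ⟨ψ, rfl, .nextI hψ⟩
  | untl φ₁ φ₂ ih₁ ih₂ =>
    rcases h with rfl | h | h
    · exact ⟨untl φ₁ φ₂, rfl, .refl _⟩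
    · obtain ⟨ψ, rfl, hψ⟩ := ih₁ h
      exact ⟨ψ, rfl, .untlL hψ⟩
    · obtain ⟨ψ, rfl, hψ⟩ := ih₂ h
      exact ⟨ψ, rfl, .untlR hψ⟩

/-- A solution of the expansion law of `A U B` that is fulfilled infinitely often is the least
solution. -/
theorem until_iff_of_expansion {A B u : ℕ → Prop} (hu : ∀ i, u i ↔ B i ∨ (A i ∧ u (i + 1)))
    (hinf : {i | B i ∨ ¬ u i}.Infinite) (i : ℕ) :
    u i ↔ ∃ j, B (i + j) ∧ ∀ k < j, A (i + k) := by
  constructor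
  · intro hi
    by_contra! hne
    have key : ∀ n, u (i + n) ∧ ∀ k < n, A (i + k) := by
      intro n
      induction n with
      | zero => exact ⟨hi, by simp⟩
      | succ n ih =>
        have hB : ¬ B (i + n) := fun hB => by
          obtain ⟨k, hk, hA⟩ := hne n hB
          exact hA (ih.2 k hk)
        obtain ⟨hA, hu'⟩ := ((hu _).1 ih.1).resolve_left hB
        refine ⟨hu', fun k hk => ?_⟩
        rcases Nat.lt_succ_iff_lt_or_eq.1 hk with hk | rfl
        · exact ih.2 k hk
        · exact hA
    obtain ⟨m, hm, him⟩ := hinf.exists_gt i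
    obtain ⟨n, rfl⟩ := Nat.exists_eq_add_of_le him.le
    rcases hm with hB | hnu
    · obtain ⟨k, hk, hA⟩ := hne n hB
      exact hA ((key n).2 k hk)
    · exact hnu (key n).1
  · rintro ⟨j, hB, hA⟩
    induction j generalizing i with
    | zero => exact (hu i).2 (Or.inl hB)
    | succ j ih =>
      refine (hu i).2 (Or.inr ⟨hA 0 j.succ_pos, ih (i + 1) ?_ fun k hk => ?_⟩)
      · rwa [Nat.add_right_comm, Nat.add_assoc]
      · rw [Nat.add_right_comm, Nat.add_assoc]
        exact hA (k + 1) (Nat.succ_lt_succ hk)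

/-- Along an accepting sequence of subsets of `el φ`, the relation `⊩` decides which subformulas
of `φ` the suffixes of the word satisfy. -/
theorem sd_iff_sat {AP : Type} {φ : LTL AP} {w : ℕ → Set AP} {ν : ℕ → Set (LTL AP)}
    (hstep : ∀ i ψ, next ψ ∈ φ.el → (next ψ ∈ ν i ↔ sd (ν (i + 1)) (w i) ψ))
    (hacc : ∀ φ₁ φ₂, Subf (untl φ₁ φ₂) φ →
      {i | sd (ν (i + 1)) (w i) φ₂ ∨ ¬ sd (ν (i + 1)) (w i) (untl φ₁ φ₂)}.Infinite)
    {χ : LTL AP} (hχ : Subf χ φ) (i : ℕ) :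
    sd (ν (i + 1)) (w i) χ ↔ Sat (fun k => w (k + i)) χ := by
  induction χ generalizing i with
  | atom p => simp [sd, Sat]
  | neg ψ ih =>
    simp only [sd, Sat, ih (.trans (.negI (.refl _)) hχ)]
  | conj ψ₁ ψ₂ ih₁ ih₂ =>
    simp only [sd, Sat, ih₁ (.trans (.conjL (.refl _)) hχ), ih₂ (.trans (.conjR (.refl _)) hχ)]
  | next ψ ih =>
    have h := hstep (i + 1) ψ (hχ.el_subset (Or.inl rfl))
    rw [ih (.trans (.nextI (.refl _)) hχ)] at h
    simpa only [sd, Sat, Nat.add_assoc, Nat.add_comm 1] using h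
  | untl ψ₁ ψ₂ ih₁ ih₂ =>
    have ih₁ := ih₁ (.trans (.untlL (.refl _)) hχ)
    have ih₂ := ih₂ (.trans (.untlR (.refl _)) hχ)
    have hu : ∀ i, sd (ν (i + 1)) (w i) (untl ψ₁ ψ₂) ↔ sd (ν (i + 1)) (w i) ψ₂ ∨
        (sd (ν (i + 1)) (w i) ψ₁ ∧ sd (ν (i + 1 + 1)) (w (i + 1)) (untl ψ₁ ψ₂)) := by
      intro i
      rw [← hstep (i + 1) _ (hχ.el_subset (Or.inl rfl))]
      rfl
    rw [until_iff_of_expansion hu (hacc ψ₁ ψ₂ hχ) i]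
    simp only [ih₁, ih₂, Sat]
    simp only [Nat.add_assoc, Nat.add_comm i]

end LTL

/-- A word accepted from the state `U` determines `U`. -/
theorem next_mem_iff_sat_of_mem_lang {AP : Type} {φ : LTL AP} {U : Set (LTL AP)}
    {w : ℕ → Set AP} (hw : w ∈ (autFrom φ U).Lang) {ψ : LTL AP} (hψ : LTL.next ψ ∈ φ.el)
    (hs : LTL.Subf ψ φ) : LTL.next ψ ∈ U ↔ LTL.Sat w ψ := by
  obtain ⟨ρ, ⟨h0, hT⟩, hacc⟩ := hw
  have h0 : ρ 0 = some U := h0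
  have hT : ∀ i, ρ (i + 1) ∈ autT φ (ρ i) (w i) := hT
  have hsome : ∀ i, ∃ W, ρ i = some W := by
    intro i
    induction i with
    | zero => exact ⟨U, h0⟩
    | succ i ih =>
      obtain ⟨W, hW⟩ := ih
      have h := hT i
      rw [hW] at h
      obtain ⟨W', hW', -⟩ := h
      exact ⟨W', hW'⟩
  choose ν hν using hsome
  have hν0 : ν 0 = U := Option.some.inj ((hν 0).symm.trans h0)
  have hstep : ∀ i ψ, LTL.next ψ ∈ φ.el →
      (LTL.next ψ ∈ ν i ↔ LTL.sd (ν (i + 1)) (w i) ψ) := by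
    intro i
    have h := hT i
    rw [hν i, hν (i + 1)] at h
    obtain ⟨W, hW, -, h⟩ := h
    rwa [Option.some.inj hW]
  have hinf : ∀ φ₁ φ₂, LTL.Subf (LTL.untl φ₁ φ₂) φ →
      {i | LTL.sd (ν (i + 1)) (w i) φ₂ ∨
        ¬ LTL.sd (ν (i + 1)) (w i) (LTL.untl φ₁ φ₂)}.Infinite := by
    intro φ₁ φ₂ h
    refine (hacc _ ⟨φ₁, φ₂, h, rfl⟩).mono ?_
    rintro i ⟨-, W, hW, h⟩
    rwa [← Option.some.inj ((hν (i + 1)).symm.trans hW)] at h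
  rw [← hν0, hstep 0 ψ hψ, LTL.sd_iff_sat hstep hinf hs 0]
  rfl

/-- For every LTL formula `φ` and all subsets `U, V ⊆ el φ` with
`U ≠ V`, the languages `L(A_φ^U)` and `L(A_φ^V)` are disjoint. -/
theorem aut_langs_disjoint {AP : Type} [Fintype AP]
    (φ : LTL AP) (U V : Set (LTL AP)) (hU : U ⊆ φ.el) (hV : V ⊆ φ.el)
    (hUV : U ≠ V) :
    (autFrom φ U).Lang ∩ (autFrom φ V).Lang = ∅ := by
  rw [Set.eq_empty_iff_forall_notMem]
  rintro w ⟨hwU, hwV⟩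
  refine hUV (Set.ext fun χ => ?_)
  by_cases hχ : χ ∈ φ.el
  · obtain ⟨ψ, rfl, hs⟩ := LTL.exists_eq_next_of_mem_el hχ
    rw [next_mem_iff_sat_of_mem_lang hwU hχ hs, next_mem_iff_sat_of_mem_lang hwV hχ hs]
  · exact iff_of_false (fun h => hχ (hU h)) (fun h => hχ (hV h))
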